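/- (Type B: all minimizing pairs yield similar combined symbols.) Let a, b ≥ 0 and let V and W be similarity classes of symbols (shift-equivalence classes of β-pairs) of rank a and rank b respectively, all of odd positive defect. Suppose (Λ_1,Ξ_1) and (Λ_2,Ξ_2) are pairs in V × W such that, for r = 1, 2, d(Λ_r) = d(Ξ_r) and a(Λ_r) + a(Ξ_r) = b(Λ_r ⊕ Ξ_r), where ⊕ is computed on representatives with matching row sizes p+2t+1 and p as in the context and b is computed with the 𝕏-reference sequence. Then Λ_1 ⊕ Ξ_1 and Λ_2 ⊕ Ξ_2 are similar in the 𝕏-family: after applying 𝕏-shifts they can be represented so that their row unions coincide and their row intersections coincide. -/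

import Mathlib

namespace CSpaper

/-- The rank of a β-set: the sum of its elements minus `choose (card) 2`. -/
def bRank (B : Finset ℕ) : ℤ :=
  (∑ b ∈ B, (b : ℤ)) - (B.card.choose 2 : ℤ)

/-- The `k`-th shift of a β-set: `{0,…,k-1} ∪ {b+k : b ∈ B}`. -/
def bShift (k : ℕ) (B : Finset ℕ) : Finset ℕ :=
  Finset.range k ∪ B.image (· + k)

/-- Shift-equivalence of β-sets. -/
def sEquiv (A B : Finset ℕ) : Prop :=
  ∃ k, bShift k A = B ∨ A = bShift k B

/-- A β-pair: an ordered pair of β-sets. -/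
abbrev BPair := Finset ℕ × Finset ℕ

/-- The defect of a β-pair. -/
def pDefect (Λ : BPair) : ℤ := (Λ.1.card : ℤ) - (Λ.2.card : ℤ)

/-- The rank of a β-pair: `rk A + rk B + ⌊(d/2)²⌋`. -/
def pRank (Λ : BPair) : ℤ := bRank Λ.1 + bRank Λ.2 + pDefect Λ ^ 2 / 4

/-- The `k`-th shift of a β-pair. -/
def pShift (k : ℕ) (Λ : BPair) : BPair := (bShift k Λ.1, bShift k Λ.2)

/-- Shift-equivalence of β-pairs: one is a shift of the other. -/
def pEquiv (Λ Ξ : BPair) : Prop := ∃ k, pShift k Λ = Ξ ∨ Λ = pShift k Ξ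

/-- `Λ` is a representative of a symbol in `𝕍_N^d`. -/
def inV (N d : ℤ) (Λ : BPair) : Prop := pRank Λ = N ∧ pDefect Λ = d

/-- The `i`-th smallest element of a finite set of naturals (0-indexed). -/
def nthEl (A : Finset ℕ) (i : ℕ) : ℕ := (A.sort (· ≤ ·)).getD i 0

/-- The operation `A ⊙ B = {a_1+b_1, a_2+b_2-1, …, a_s+b_s-(s-1)}` (0-indexed:
`a_i + b_i - i`). -/
def odot (A B : Finset ℕ) : Finset ℕ :=
  (Finset.range A.card).image fun i => nthEl A i + nthEl B i - i

/-- Dominance order `B ⊴ A`: every tail sum of `B` is at most the corresponding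
tail sum of `A`. -/
def domLE (B A : Finset ℕ) : Prop :=
  ∀ k, ∑ i ∈ Finset.Ico k B.card, nthEl B i ≤ ∑ i ∈ Finset.Ico k A.card, nthEl A i

/-- No two consecutive integers. -/
def noConsec (S : Finset ℕ) : Prop := ∀ x ∈ S, x + 1 ∉ S

/-- `{0,2,…,2k-2} ∪ {x+2k : x ∈ S}`. -/
def evShift (k : ℕ) (S : Finset ℕ) : Finset ℕ :=
  (Finset.range k).image (fun i => 2 * i) ∪ S.image (· + 2 * k)

/-- `{1,3,…,2k-1} ∪ {y+2k : y ∈ S}`. -/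
def odShift (k : ℕ) (S : Finset ℕ) : Finset ℕ :=
  (Finset.range k).image (fun i => 2 * i + 1) ∪ S.image (· + 2 * k)

/-- The `k`-th shift in the 𝕐-family. -/
def yShift (k : ℕ) (P : BPair) : BPair := (evShift k P.1, odShift k P.2)

/-- The `k`-th shift in the 𝕏-family. -/
def xShift (k : ℕ) (P : BPair) : BPair := (evShift k P.1, evShift k P.2)

/-- Shift-equivalence in the 𝕐-family. -/
def yEquiv (P Q : BPair) : Prop := ∃ k, yShift k P = Q ∨ P = yShift k Q

/-- Shift-equivalence in the 𝕏-family (unordered pairs, so swaps are allowed). -/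
def xEquiv (P Q : BPair) : Prop :=
  ∃ k, xShift k P = Q ∨ xShift k P = Q.swap ∨ P = xShift k Q ∨ P.swap = xShift k Q

/-- Membership in `Ỹ_N`. -/
def inYtilde (N : ℤ) (P : BPair) : Prop :=
  (∀ y ∈ P.2, 0 < y) ∧ Odd (P.1.card + P.2.card) ∧ noConsec P.1 ∧ noConsec P.2 ∧
    2 * ((∑ x ∈ P.1, (x : ℤ)) + ∑ y ∈ P.2, (y : ℤ)) =
      N + ((P.1.card + P.2.card : ℕ) : ℤ) * (((P.1.card + P.2.card : ℕ) : ℤ) - 1)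

/-- The defect in the 𝕐-family: `|X| - |Y|`. -/
def yDefect (P : BPair) : ℤ := (P.1.card : ℤ) - (P.2.card : ℤ)

/-- Membership in `X̃_N`. -/
def inXtilde (N : ℤ) (P : BPair) : Prop :=
  noConsec P.1 ∧ noConsec P.2 ∧
    2 * ((∑ x ∈ P.1, (x : ℤ)) + ∑ y ∈ P.2, (y : ℤ)) =
      N + (((P.1.card + P.2.card : ℕ) : ℤ) - 1) ^ 2 - 1

/-- The defect in the 𝕏-family: `||A| - |B||`. -/
def xDefect (P : BPair) : ℤ := |(P.1.card : ℤ) - (P.2.card : ℤ)|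

/-- The map `Θ(A,B) = ({0, a_1+2, …, a_s+s+1}, {b_1+1, …, b_s+s})`. -/
def theta (Λ : BPair) : BPair :=
  (insert 0 ((Finset.range Λ.1.card).image fun i => nthEl Λ.1 i + i + 2),
   (Finset.range Λ.2.card).image fun i => nthEl Λ.2 i + i + 1)

/-- The map `Θ'(A,B) = ({0, a_1+2, …, a_s+s+1}, {b_1, …, b_s+s-1})`. -/
def theta' (Λ : BPair) : BPair :=
  (insert 0 ((Finset.range Λ.1.card).image fun i => nthEl Λ.1 i + i + 2),
   (Finset.range Λ.2.card).image fun i => nthEl Λ.2 i + i)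

/-- The map `Θ̄(A,B) = ({a_1, …, a_s+s-1}, {b_1, …, b_s+s-1})`. -/
def thetaBar (Λ : BPair) : BPair :=
  ((Finset.range Λ.1.card).image fun i => nthEl Λ.1 i + i,
   (Finset.range Λ.2.card).image fun i => nthEl Λ.2 i + i)

/-- `ᵀΘ(A,B) = Θ(B,A)`. -/
def thetaT (Λ : BPair) : BPair := theta (Λ.2, Λ.1)

/-- `Π^d` for `d ≥ 1`: adjoin `{0,2,…,2d-4}` to the first row and add `2d-2`
to its entries. -/
def piPos (d : ℕ) (P : BPair) : BPair := (evShift (d - 1) P.1, P.2)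

/-- `Π^d` for `d = -e ≤ -1`: adjoin `{1,3,…,2e+1}` to the second row and add
`2e+2` to its entries. -/
def piNeg (e : ℕ) (P : BPair) : BPair := (P.1, odShift (e + 1) P.2)

/-- `Δ_B^t = Π^{2t+1} ∘ Θ'`. -/
def deltaB (t : ℕ) (Λ : BPair) : BPair := piPos (2 * t + 1) (theta' Λ)

/-- `Δ_C^t = Π^{4t+1} ∘ Θ`. -/
def deltaC (t : ℕ) (Λ : BPair) : BPair := piPos (4 * t + 1) (theta Λ)

/-- `Δ_{C'}^t = Π^{1-4t} ∘ ᵀΘ` (for `t ≥ 1`). -/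
def deltaC' (t : ℕ) (Λ : BPair) : BPair := piNeg (4 * t - 1) (thetaT Λ)

/-- `Δ_D^t = Π^{4t} ∘ Θ'` (for `t ≥ 1`). -/
def deltaD (t : ℕ) (Λ : BPair) : BPair := piPos (4 * t) (theta' Λ)

/-- `Δ_D^0 = Θ̄`. -/
def deltaD0 (Λ : BPair) : BPair := thetaBar Λ

/-- All entries of a pair (with multiplicity) in weakly increasing order. -/
def entries (P : BPair) : List ℕ := (P.1.val + P.2.val).sort (· ≤ ·)

/-- `Σ_j (len-1-j) ⬝ (L[j] - ref j)`, the common shape of `a`, `b` and `σ`. -/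
def wsum (L : List ℕ) (ref : ℕ → ℕ) : ℤ :=
  ∑ j ∈ Finset.range L.length,
    ((L.length - 1 - j : ℕ) : ℤ) * ((L.getD j 0 : ℤ) - (ref j : ℤ))

/-- Lusztig's a-function (reference sequence `0,0,1,1,…`). -/
def aFun (P : BPair) : ℤ := wsum (entries P) (fun j => j / 2)

/-- Lusztig's b-function with the 𝕏-reference sequence `0,0,2,2,…`. -/
def bX (P : BPair) : ℤ := wsum (entries P) (fun j => 2 * (j / 2))

/-- Lusztig's b-function with the 𝕐-reference sequence `0,1,2,…`. -/
def bY (P : BPair) : ℤ := wsum (entries P) (fun j => j)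

/-- `σ(Λ) = Σ (2k-i)·x_i`. -/
def sigmaFun (P : BPair) : ℤ := wsum (entries P) (fun _ => 0)

/-- Entrywise sum of two rows (of equal size), sorted positions added. -/
def addRows (X X' : Finset ℕ) : Finset ℕ :=
  (Finset.range X.card).image fun i => nthEl X i + nthEl X' i

/-- `Λ ⊕ Ξ` in the types B and D cases. -/
def oplus (Λ Ξ : BPair) : BPair := (addRows Λ.1 Ξ.1, addRows Λ.2 Ξ.2)

/-- `Λ ⊕ Ξ` in the type C case. -/
def oplusC (Λ Ξ : BPair) : BPair :=
  (insert (nthEl Ξ.1 0)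
      ((Finset.range Λ.1.card).image fun i => nthEl Λ.1 i + nthEl Ξ.1 (i + 1) + 1),
   (Finset.range Λ.2.card).image fun j => nthEl Λ.2 j + nthEl Ξ.2 j + 1)

/-- `Λ ⊞ Ξ`: the twisted combination in type D. -/
def boxplus (Λ Ξ : BPair) : BPair := (addRows Λ.2 Ξ.1, addRows Λ.1 Ξ.2)

/-- Similarity of β-pairs: after shifts, the row unions and row intersections
coincide. -/
def pSimilar (Λ Ξ : BPair) : Prop :=
  ∃ j k, (pShift j Λ).1 ∪ (pShift j Λ).2 = (pShift k Ξ).1 ∪ (pShift k Ξ).2 ∧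
    (pShift j Λ).1 ∩ (pShift j Λ).2 = (pShift k Ξ).1 ∩ (pShift k Ξ).2

/-- Similarity in the 𝕏-family: after 𝕏-shifts, the row unions and
intersections coincide. -/
def xSimilar (P Q : BPair) : Prop :=
  ∃ j k, (xShift j P).1 ∪ (xShift j P).2 = (xShift k Q).1 ∪ (xShift k Q).2 ∧
    (xShift j P).1 ∩ (xShift j P).2 = (xShift k Q).1 ∩ (xShift k Q).2

/-- A β-pair is reduced if it is not a proper shift, i.e. `0` does not lie in
both rows; each shift-equivalence class has a unique reduced representative. -/
def reduced (Λ : BPair) : Prop := ¬ (0 ∈ Λ.1 ∧ 0 ∈ Λ.2)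

/-- `a(Λ) + a(Ξ) = b(Λ⊕Ξ)`, computed (as in the paper) on shift-representatives
with matching row sizes. -/
def minimalPair (Λ Ξ : BPair) : Prop :=
  ∃ Λ' Ξ', pEquiv Λ Λ' ∧ pEquiv Ξ Ξ' ∧ Λ'.1.card = Ξ'.1.card ∧
    Λ'.2.card = Ξ'.2.card ∧ aFun Λ' + aFun Ξ' = bX (oplus Λ' Ξ')

/-- The generating relation `i ≈ i+1` whenever `c_i = c_{i+1}` or `d_i = d_{i+1}`. -/
def linkRel (n : ℕ) (c d : ℕ → ℕ) (i j : Fin n) : Prop :=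
  (j : ℕ) = (i : ℕ) + 1 ∧ (c i = c j ∨ d i = d j)

/-- The equivalence relation generated by `linkRel`. -/
def idxSetoid (n : ℕ) (c d : ℕ → ℕ) : Setoid (Fin n) :=
  ⟨Relation.EqvGen (linkRel n c d), Relation.EqvGen.is_equivalence _⟩

/-- A degenerate equivalence class: `{i, i+1}` with `c_i = c_{i+1}` and
`d_i = d_{i+1}`. -/
def degenClass (n : ℕ) (c d : ℕ → ℕ) (Q : Quotient (idxSetoid n c d)) : Prop :=
  ∃ i j : Fin n, (j : ℕ) = (i : ℕ) + 1 ∧ c i = c j ∧ d i = d j ∧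
    Q = Quotient.mk (idxSetoid n c d) i ∧
    ∀ m : Fin n, Quotient.mk (idxSetoid n c d) m = Q → m = i ∨ m = j

/-- The number `ℓ` of non-degenerate equivalence classes. -/
noncomputable def ellCount (n : ℕ) (c d : ℕ → ℕ) : ℕ :=
  Nat.card {Q : Quotient (idxSetoid n c d) // ¬ degenClass n c d Q}

/-- `Ξ` is obtained from `Λ` by decreasing a single entry by `1`, the result
again being a β-pair. -/
def stepDown (Λ Ξ : BPair) : Prop :=
  (∃ x ∈ Λ.1, 0 < x ∧ x - 1 ∉ Λ.1 ∧ Ξ = (insert (x - 1) (Λ.1.erase x), Λ.2)) ∨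
  (∃ x ∈ Λ.2, 0 < x ∧ x - 1 ∉ Λ.2 ∧ Ξ = (Λ.1, insert (x - 1) (Λ.2.erase x)))

/-- `Σ (len-1-j) * l[j]`, the weighted sum underlying `wsum`. -/
def weightedSum : List ℕ → ℕ
  | [] => 0
  | a :: l => l.length * a + weightedSum l

/-- The sum of `min x y` over all pairs of positions in a list. -/
def pairMinSum : List ℕ → ℕ
  | [] => 0
  | a :: l => (l.map (min a)).sum + pairMinSum l

lemma pairMinSum_perm {l l' : List ℕ} (h : l.Perm l') : pairMinSum l = pairMinSum l' := by
  induction h with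
  | nil => rfl
  | cons a h ih => simp [pairMinSum, ih, (h.map (min a)).sum_eq]
  | swap a b l => simp [pairMinSum, min_comm a b]; omega
  | trans _ _ ih₁ ih₂ => exact ih₁.trans ih₂

lemma sum_map_min_le (a : ℕ) (l : List ℕ) : (l.map (min a)).sum ≤ l.length * a := by
  induction l with
  | nil => simp
  | cons b l ih =>
    have := min_le_left a b
    simp only [List.map_cons, List.sum_cons, List.length_cons, Nat.succ_mul]
    omega

lemma sum_map_min_eq_iff (a : ℕ) (l : List ℕ) :
    (l.map (min a)).sum = l.length * a ↔ ∀ b ∈ l, a ≤ b := by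
  induction l with
  | nil => simp
  | cons b l ih =>
    have h₁ := min_le_left a b
    have h₂ := sum_map_min_le a l
    simp only [List.map_cons, List.sum_cons, List.length_cons, Nat.succ_mul, List.forall_mem_cons,
      ← ih]
    omega

lemma pairMinSum_le (l : List ℕ) : pairMinSum l ≤ weightedSum l := by
  induction l with
  | nil => rfl
  | cons a l ih => exact Nat.add_le_add (sum_map_min_le a l) ih

lemma pairMinSum_eq_iff (l : List ℕ) : pairMinSum l = weightedSum l ↔ l.Pairwise (· ≤ ·) := by
  induction l with
  | nil => simp [pairMinSum, weightedSum]
  | cons a l ih =>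
    have h₁ := sum_map_min_le a l
    have h₂ := pairMinSum_le l
    rw [List.pairwise_cons, ← ih, ← sum_map_min_eq_iff]
    simp only [pairMinSum, weightedSum]
    omega

lemma weightedSum_map_add (Q : List (ℕ × ℕ)) :
    weightedSum (Q.map fun p => p.1 + p.2) =
      weightedSum (Q.map Prod.fst) + weightedSum (Q.map Prod.snd) := by
  induction Q with
  | nil => rfl
  | cons p Q ih => simp only [List.map_cons, weightedSum, List.length_map, ih]; ring

lemma wsum_eq (l : List ℕ) (ref : ℕ → ℕ) :
    wsum l ref = (weightedSum l : ℤ) -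
      ∑ j ∈ Finset.range l.length, ((l.length - 1 - j : ℕ) : ℤ) * (ref j : ℤ) := by
  have key : ∑ j ∈ Finset.range l.length, ((l.length - 1 - j : ℕ) : ℤ) * (l.getD j 0 : ℤ) =
      weightedSum l := by
    induction l with
    | nil => simp [weightedSum]
    | cons a l ih =>
      rw [List.length_cons, Finset.sum_range_succ', weightedSum]
      push_cast
      rw [← ih, add_comm]
      congr 1
      refine Finset.sum_congr rfl fun j _ => ?_
      rw [show l.length - (j + 1) = l.length - 1 - j by omega]
      simp
  simp only [wsum, mul_sub, Finset.sum_sub_distrib, key]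

/-- If the sorted sums of a list of pairs have the least possible weighted sum, they are the
entrywise sums of the sorted first and second coordinates. -/
lemma eq_zipWith_of_weightedSum_eq (P : List (ℕ × ℕ)) {c d e : List ℕ}
    (hc : c.Pairwise (· ≤ ·)) (hd : d.Pairwise (· ≤ ·)) (he : e.Pairwise (· ≤ ·))
    (hPc : (P.map Prod.fst).Perm c) (hPd : (P.map Prod.snd).Perm d)
    (hPe : (P.map fun p => p.1 + p.2).Perm e)
    (h : weightedSum c + weightedSum d = weightedSum e) :
    e = List.zipWith (· + ·) c d := by
  let r : ℕ × ℕ → ℕ × ℕ → Prop := fun p q => p.1 + p.2 ≤ q.1 + q.2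
  have : DecidableRel r := fun _ _ => Nat.decLe _ _
  let Q := P.insertionSort r
  have hQP : Q.Perm P := List.perm_insertionSort r P
  have hsort : (Q.map fun p => p.1 + p.2).Pairwise (· ≤ ·) := by
    rw [List.pairwise_map]
    have : Std.Total r := ⟨fun p q => le_total (p.1 + p.2) (q.1 + q.2)⟩
    have : IsTrans _ r := ⟨fun _ _ _ h h' => le_trans (α := ℕ) h h'⟩
    exact List.pairwise_insertionSort r P
  have hQc := (hQP.map Prod.fst).trans hPc
  have hQd := (hQP.map Prod.snd).trans hPd
  have hQe : (Q.map fun p => p.1 + p.2) = e :=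
    ((hQP.map _).trans hPe).eq_of_pairwise' hsort he
  have h₁ := pairMinSum_le (Q.map Prod.fst)
  have h₂ := pairMinSum_le (Q.map Prod.snd)
  have h₃ := (pairMinSum_eq_iff c).2 hc
  have h₄ := (pairMinSum_eq_iff d).2 hd
  have h₅ := weightedSum_map_add Q
  rw [← pairMinSum_perm hQc] at h₃
  rw [← pairMinSum_perm hQd] at h₄
  rw [hQe] at h₅
  have hQc' := hQc.eq_of_pairwise' ((pairMinSum_eq_iff _).1 (by omega)) hc
  have hQd' := hQd.eq_of_pairwise' ((pairMinSum_eq_iff _).1 (by omega)) hd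
  rw [← hQe, ← hQc', ← hQd', List.zipWith_map, List.zipWith_self]

/-- The effect of the `m`-th shift with step `c` on the sorted list of entries of a pair. -/
def listShift (c : ℕ) : ℕ → List ℕ → List ℕ
  | 0, l => l
  | m + 1, l => 0 :: 0 :: (listShift c m l).map (· + c)

lemma length_listShift (c m : ℕ) (l : List ℕ) :
    (listShift c m l).length = l.length + 2 * m := by
  induction m with
  | zero => rfl
  | succ m ih => simp [listShift, ih]; ring

lemma pairwise_listShift (c m : ℕ) {l : List ℕ} (h : l.Pairwise (· ≤ ·)) :
    (listShift c m l).Pairwise (· ≤ ·) := by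
  induction m with
  | zero => exact h
  | succ m ih => simpa [listShift, List.pairwise_map] using ih

lemma listShift_cancel (c j m : ℕ) {l l' : List ℕ}
    (h : listShift c j l = listShift c (j + m) l') : l = listShift c m l' := by
  induction j with
  | zero => simpa [listShift] using h
  | succ j ih =>
    rw [Nat.add_right_comm] at h
    simp only [listShift, List.cons.injEq, true_and] at h
    exact ih (List.map_injective_iff.2 (add_left_injective c) h)

lemma zipWith_listShift (m : ℕ) (l l' : List ℕ) :
    List.zipWith (· + ·) (listShift 1 m l) (listShift 1 m l') =
      listShift 2 m (List.zipWith (· + ·) l l') := by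
  induction m with
  | zero => rfl
  | succ m ih =>
    simp only [listShift, List.zipWith_cons_cons, ← ih, List.zipWith_map, List.map_zipWith]
    congr 4
    funext a b
    omega

lemma coe_listShift (c m : ℕ) (l : List ℕ) :
    (listShift c m l : Multiset ℕ) = (Multiset.range m).map (c * ·) +
      (Multiset.range m).map (c * ·) + (l : Multiset ℕ).map (· + c * m) := by
  induction m with
  | zero => simp [listShift]
  | succ m ih =>
    have hr : (Multiset.range (m + 1)).map (c * ·) =
        0 ::ₘ ((Multiset.range m).map (c * ·)).map (· + c) := by
      simp only [← Multiset.coe_range, List.range_succ_eq_map]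
      simp [Function.comp_def, mul_add]
    have hl : (l : Multiset ℕ).map (· + c * (m + 1)) =
        ((l : Multiset ℕ).map (· + c * m)).map (· + c) := by
      rw [Multiset.map_map]
      exact Multiset.map_congr rfl fun x _ => by simp only [Function.comp_apply]; ring
    rw [hr, hl, listShift, ← Multiset.cons_coe, ← Multiset.cons_coe, ← Multiset.map_coe, ih,
      Multiset.map_add, Multiset.map_add, Multiset.cons_add, Multiset.add_cons, Multiset.cons_add,
      Multiset.cons_add]

lemma coe_entries (P : BPair) : (entries P : Multiset ℕ) = P.1.val + P.2.val :=
  Multiset.sort_eq _ _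

lemma pairwise_entries (P : BPair) : (entries P).Pairwise (· ≤ ·) :=
  Multiset.pairwise_sort _ _

lemma length_entries (P : BPair) : (entries P).length = P.1.card + P.2.card := by
  rw [← Multiset.coe_card, coe_entries, Multiset.card_add]; rfl

lemma bShift_val (k : ℕ) (B : Finset ℕ) :
    (bShift k B).val = (Multiset.range k).map (1 * ·) + B.val.map (· + 1 * k) := by
  have hd : Disjoint (Finset.range k) (B.image (· + k)) := by
    rw [Finset.disjoint_left]
    intro x hx hx'
    obtain ⟨y, -, rfl⟩ := Finset.mem_image.1 hx'
    simp at hx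
  rw [bShift, ← Finset.disjUnion_eq_union _ _ hd, Finset.disjUnion_val,
    Finset.image_val_of_injOn (add_left_injective k).injOn]
  simp

lemma evShift_val (k : ℕ) (B : Finset ℕ) :
    (evShift k B).val = (Multiset.range k).map (2 * ·) + B.val.map (· + 2 * k) := by
  have hd : Disjoint ((Finset.range k).image (fun i => 2 * i)) (B.image (· + 2 * k)) := by
    rw [Finset.disjoint_left]
    intro x hx hx'
    obtain ⟨y, -, rfl⟩ := Finset.mem_image.1 hx'
    obtain ⟨z, hz, hz'⟩ := Finset.mem_image.1 hx
    simp at hz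
    omega
  rw [evShift, ← Finset.disjUnion_eq_union _ _ hd, Finset.disjUnion_val,
    Finset.image_val_of_injOn (add_left_injective (2 * k)).injOn,
    Finset.image_val_of_injOn (fun a _ b _ h => by simpa using h)]
  rfl

lemma entries_pShift (k : ℕ) (P : BPair) : entries (pShift k P) = listShift 1 k (entries P) := by
  refine List.Perm.eq_of_pairwise' (pairwise_entries _)
    (pairwise_listShift 1 k (pairwise_entries P)) ?_
  rw [← Multiset.coe_eq_coe, coe_entries, coe_listShift, coe_entries, pShift, bShift_val,
    bShift_val, Multiset.map_add]
  abel

lemma entries_xShift (k : ℕ) (P : BPair) : entries (xShift k P) = listShift 2 k (entries P) := by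
  refine List.Perm.eq_of_pairwise' (pairwise_entries _)
    (pairwise_listShift 2 k (pairwise_entries P)) ?_
  rw [← Multiset.coe_eq_coe, coe_entries, coe_listShift, coe_entries, xShift, evShift_val,
    evShift_val, Multiset.map_add]
  abel

lemma entries_eq_iff (P Q : BPair) :
    entries P = entries Q ↔ P.1 ∪ P.2 = Q.1 ∪ Q.2 ∧ P.1 ∩ P.2 = Q.1 ∩ Q.2 := by
  have hval : ∀ R : BPair, R.1.val + R.2.val = (R.1 ∪ R.2).val + (R.1 ∩ R.2).val := fun R => by
    rw [Finset.union_val, Finset.inter_val, Multiset.union_add_inter]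
  constructor
  · intro h
    have hc : ∀ x, (P.1.val + P.2.val).count x = (Q.1.val + Q.2.val).count x := by
      rw [← coe_entries, h, coe_entries]
      exact fun _ => rfl
    simp only [Multiset.count_add, Multiset.count_eq_of_nodup (Finset.nodup _),
      Finset.mem_val] at hc
    constructor <;> ext x <;> have := hc x <;>
      simp only [Finset.mem_union, Finset.mem_inter] <;> grind
  · rintro ⟨h₁, h₂⟩
    rw [entries, entries, hval P, hval Q, h₁, h₂]

lemma map_nthEl (A : Finset ℕ) : (Multiset.range A.card).map (nthEl A) = A.val := by
  have h : (List.range A.card).map (nthEl A) = A.sort (· ≤ ·) := by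
    refine List.ext_getElem (by simp) fun i h₁ h₂ => ?_
    rw [List.getElem_map, List.getElem_range, nthEl, List.getD_eq_getElem _ _ h₂]
  rw [← Multiset.coe_range, Multiset.map_coe, h, Finset.sort_eq]

lemma nthEl_strictMonoOn (A : Finset ℕ) : StrictMonoOn (nthEl A) (Finset.range A.card) := by
  intro i hi j hj hij
  simp only [Finset.coe_range, Set.mem_Iio] at hi hj
  rw [← Finset.length_sort (· ≤ ·)] at hi hj
  rw [nthEl, nthEl, List.getD_eq_getElem _ _ hi, List.getD_eq_getElem _ _ hj]
  exact List.pairwise_iff_getElem.1 (Finset.sortedLT_sort A).pairwise i j hi hj hij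

lemma addRows_val {A B : Finset ℕ} (h : A.card = B.card) :
    (addRows A B).val = (Multiset.range A.card).map fun i => nthEl A i + nthEl B i := by
  have hB := nthEl_strictMonoOn B
  rw [← h] at hB
  rw [addRows, Finset.image_val_of_injOn ((nthEl_strictMonoOn A).add hB).injOn]
  rfl

lemma entries_oplus {L X : BPair} (h₁ : L.1.card = X.1.card) (h₂ : L.2.card = X.2.card)
    (hm : aFun L + aFun X = bX (oplus L X)) :
    entries (oplus L X) = List.zipWith (· + ·) (entries L) (entries X) := by
  let P : List (ℕ × ℕ) := (List.range L.1.card).map (fun i => (nthEl L.1 i, nthEl X.1 i)) ++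
    (List.range L.2.card).map (fun i => (nthEl L.2 i, nthEl X.2 i))
  have hcoe : (P : Multiset (ℕ × ℕ)) =
      (Multiset.range L.1.card).map (fun i => (nthEl L.1 i, nthEl X.1 i)) +
        (Multiset.range L.2.card).map (fun i => (nthEl L.2 i, nthEl X.2 i)) := rfl
  have hlX : (entries X).length = (entries L).length := by
    rw [length_entries, length_entries, h₁, h₂]
  have hPe : (P.map fun p => p.1 + p.2).Perm (entries (oplus L X)) := by
    rw [← Multiset.coe_eq_coe, ← Multiset.map_coe, hcoe, coe_entries, oplus, addRows_val h₁,
      addRows_val h₂]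
    simp
  have hPc : (P.map Prod.fst).Perm (entries L) := by
    rw [← Multiset.coe_eq_coe, ← Multiset.map_coe, hcoe, coe_entries, ← map_nthEl, ← map_nthEl]
    simp
  have hPd : (P.map Prod.snd).Perm (entries X) := by
    rw [← Multiset.coe_eq_coe, ← Multiset.map_coe, hcoe, coe_entries, ← map_nthEl, ← map_nthEl,
      h₁, h₂]
    simp
  have hle : (entries (oplus L X)).length = (entries L).length := by
    rw [← hPe.length_eq, ← hPc.length_eq, List.length_map, List.length_map]
  refine eq_zipWith_of_weightedSum_eq P (pairwise_entries _) (pairwise_entries _)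
    (pairwise_entries _) hPc hPd hPe ?_
  simp only [aFun, bX, wsum_eq, hle, hlX, Nat.cast_mul, mul_left_comm _ ((2 : ℕ) : ℤ),
    ← Finset.mul_sum] at hm
  push_cast at hm
  zify
  linarith

/-- Matching shifts on the entries of two pairs give a shift on the entries of their sum. -/
lemma xSimilar_oplus_of_listShift {L X L' X' : BPair} (m : ℕ)
    (hL : entries L = listShift 1 m (entries L')) (hX : entries X = listShift 1 m (entries X'))
    (h : entries (oplus L X) = List.zipWith (· + ·) (entries L) (entries X))
    (h' : entries (oplus L' X') = List.zipWith (· + ·) (entries L') (entries X')) :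
    entries (xShift 0 (oplus L X)) = entries (xShift m (oplus L' X')) := by
  rw [entries_xShift, entries_xShift, h, h', hL, hX, zipWith_listShift]
  rfl

/-- type B: minimizing pairs give similar combined symbols:
if `(Λ₁,Ξ₁)` and `(Λ₂,Ξ₂)` lie in common similarity classes `V × W` of ranks
`a`, `b` (all of odd positive defect), have matching row sizes and both
satisfy `a(Λ_r)+a(Ξ_r) = b(Λ_r⊕Ξ_r)`, then `Λ₁⊕Ξ₁` and `Λ₂⊕Ξ₂` are similar
in the 𝕏-family. -/
theorem statement_17 (a b : ℕ) (L1 X1 L2 X2 : BPair)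
    (hra1 : pRank L1 = a) (hra2 : pRank L2 = a)
    (hrb1 : pRank X1 = b) (hrb2 : pRank X2 = b)
    (ho1 : Odd (pDefect L1) ∧ 0 < pDefect L1)
    (ho2 : Odd (pDefect L2) ∧ 0 < pDefect L2)
    (ho3 : Odd (pDefect X1) ∧ 0 < pDefect X1)
    (ho4 : Odd (pDefect X2) ∧ 0 < pDefect X2)
    (hV : pSimilar L1 L2) (hW : pSimilar X1 X2)
    (hd1 : pDefect L1 = pDefect X1) (hd2 : pDefect L2 = pDefect X2)
    (hc1 : L1.1.card = X1.1.card) (hc1' : L1.2.card = X1.2.card)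
    (hc2 : L2.1.card = X2.1.card) (hc2' : L2.2.card = X2.2.card)
    (hm1 : aFun L1 + aFun X1 = bX (oplus L1 X1))
    (hm2 : aFun L2 + aFun X2 = bX (oplus L2 X2)) :
    xSimilar (oplus L1 X1) (oplus L2 X2) := by
  obtain ⟨j, k, hL⟩ := hV
  obtain ⟨j', k', hX⟩ := hW
  rw [← entries_eq_iff, entries_pShift, entries_pShift] at hL hX
  have e₁ := entries_oplus hc1 hc1' hm1
  have e₂ := entries_oplus hc2 hc2' hm2
  have hl := congrArg List.length hL
  have hl' := congrArg List.length hX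
  simp only [length_listShift, length_entries] at hl hl'
  rcases le_total j k with hjk | hjk
  · obtain ⟨m, rfl⟩ := Nat.exists_eq_add_of_le hjk
    obtain rfl : k' = j' + m := by omega
    exact ⟨0, m, (entries_eq_iff _ _).1 (xSimilar_oplus_of_listShift m
      (listShift_cancel 1 j m hL) (listShift_cancel 1 j' m hX) e₁ e₂)⟩
  · obtain ⟨m, rfl⟩ := Nat.exists_eq_add_of_le hjk
    obtain rfl : j' = k' + m := by omega
    exact ⟨m, 0, (entries_eq_iff _ _).1 (xSimilar_oplus_of_listShift m
      (listShift_cancel 1 k m hL.symm) (listShift_cancel 1 k' m hX.symm) e₂ e₁).symm⟩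

end CSpaper
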